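/- arXiv:2106.10725 — 6 statements merged into one kernel-verified Lean document; each statement's English description precedes it below -/
import Mathlib

section
/- Consider the complex Lorenz system in real coordinates: ẋ₁ = σ(x₃−x₁), ẋ₂ = σ(x₄−x₂), ẋ₃ = r₁x₁ − r₂x₂ − x₃ − e x₄ − x₁x₅, ẋ₄ = r₂x₁ + r₁x₂ + e x₃ − x₄ − x₂x₅, ẋ₅ = −bx₅ + x₁x₃ + x₂x₄. All eigenvalues of the Jacobian matrix of the right-hand side at the equilibrium S₀ = (0,0,0,0,0) have negative real part if and only if r₁ < r₁c, where r₁c = 1 + (e + r₂)(e − σ r₂)/(σ + 1)². -/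
open Complex

/-- The real-coordinate form of `μ² + (A - i e) μ + (C - i D) = 0`. -/
theorem complex_quadratic_eq_zero_iff (A e C D : ℝ) (μ : ℂ) :
    μ ^ 2 + (A - I * e) * μ + (C - I * D) = 0 ↔
      μ.re ^ 2 - μ.im ^ 2 + A * μ.re + e * μ.im + C = 0 ∧
        (2 * μ.re + A) * μ.im = e * μ.re + D := by
  rw [Complex.ext_iff]
  simp only [pow_two, add_re, mul_re, sub_re, ofReal_re, ofReal_im, I_re, I_im, add_im, mul_im,
    sub_im, zero_re, zero_im]
  constructor
  · rintro ⟨h₁, h₂⟩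
    constructor <;> linarith
  · rintro ⟨h₁, h₂⟩
    constructor <;> linarith

/-- Elimination of the imaginary part `y` from the real and imaginary parts of a complex
quadratic equation. -/
theorem complex_quadratic_resultant {A e C D x y : ℝ}
    (h : (2 * x + A) * y = e * x + D) :
    (2 * x + A) ^ 2 * (x ^ 2 - y ^ 2 + A * x + e * y + C) =
      (x ^ 2 + A * x) * ((2 * x + A) ^ 2 + 4 * C + e ^ 2)
        + (C * A ^ 2 + e * D * A - D ^ 2) := by
  linear_combination (-((2 * x + A) * y + (e * x + D)) + e * (2 * x + A)) * h

theorem re_neg_of_complex_quadratic {A e C D : ℝ} (hA : 0 < A)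
    (hK : 0 < C * A ^ 2 + e * D * A - D ^ 2) {μ : ℂ}
    (hμ : μ ^ 2 + (A - I * e) * μ + (C - I * D) = 0) : μ.re < 0 := by
  obtain ⟨h₁, h₂⟩ := (complex_quadratic_eq_zero_iff A e C D μ).1 hμ
  by_contra! hx
  have h := complex_quadratic_resultant (C := C) h₂
  rw [h₁, mul_zero] at h
  have hC : 0 < 4 * C + e ^ 2 := by
    refine (mul_pos_iff_of_pos_left (pow_pos hA 2)).1 ?_
    nlinarith [sq_nonneg (e * A - 2 * D)]
  have : 0 ≤ (μ.re ^ 2 + A * μ.re) * ((2 * μ.re + A) ^ 2 + 4 * C + e ^ 2) := by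
    apply mul_nonneg
    · positivity
    · nlinarith [sq_nonneg (2 * μ.re + A)]
  linarith

theorem exists_complex_quadratic_root_re_nonneg {A e C D : ℝ} (hA : 0 < A)
    (hK : C * A ^ 2 + e * D * A - D ^ 2 ≤ 0) :
    ∃ μ : ℂ, μ ^ 2 + (A - I * e) * μ + (C - I * D) = 0 ∧ 0 ≤ μ.re := by
  set K := C * A ^ 2 + e * D * A - D ^ 2
  let f : ℝ → ℝ := fun x => (x ^ 2 + A * x) * ((2 * x + A) ^ 2 + 4 * C + e ^ 2) + K
  let X := 1 + |C| + |K|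
  have hX : 1 ≤ X := by
    have := abs_nonneg C
    have := abs_nonneg K
    simp only [X]; linarith
  have hfX : 0 ≤ f X := by
    have hsq : X ≤ X ^ 2 := by nlinarith
    have hC : 1 ≤ (2 * X + A) ^ 2 + 4 * C + e ^ 2 := by
      have := neg_abs_le C
      have := abs_nonneg K
      have : X = 1 + |C| + |K| := rfl
      nlinarith [sq_nonneg e, mul_pos hA (by linarith : 0 < X), sq_nonneg A]
    have hXK : |K| ≤ X ^ 2 + A * X := by
      have := abs_nonneg C
      have : X = 1 + |C| + |K| := rfl
      nlinarith [mul_pos hA (by linarith : 0 < X)]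
    have : X ^ 2 + A * X ≤ (X ^ 2 + A * X) * ((2 * X + A) ^ 2 + 4 * C + e ^ 2) :=
      le_mul_of_one_le_right (by positivity) hC
    have := neg_abs_le K
    simp only [f]; linarith
  have hf0 : f 0 ≤ 0 := by simpa [f] using hK
  obtain ⟨x, ⟨hx, -⟩, hfx⟩ := intermediate_value_Icc (f := f) (by linarith : (0 : ℝ) ≤ X)
    (by fun_prop) ⟨hf0, hfX⟩
  have hd : 0 < 2 * x + A := by linarith
  have hy : (2 * x + A) * ((e * x + D) / (2 * x + A)) = e * x + D := mul_div_cancel₀ _ hd.ne'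
  refine ⟨⟨x, (e * x + D) / (2 * x + A)⟩,
    (complex_quadratic_eq_zero_iff A e C D _).2 ⟨?_, hy⟩, hx⟩
  have h := complex_quadratic_resultant (C := C) hy
  exact (mul_eq_zero.1 (h.trans hfx)).resolve_left (by positivity)

/-- The eigenvalue equations of the two-dimensional complex system
`u' = σ (w - u)`, `w' = (r₁ + i r₂) u - (1 - i e) w`: an eigenvalue with a nonzero
eigenvector solves the characteristic equation. -/
theorem complex_lorenz_block {σ r₁ r₂ e : ℝ} (hσ : 0 < σ) {μ u w : ℂ}
    (h₁ : σ * (w - u) = μ * u) (h₂ : (r₁ + I * r₂) * u - (1 - I * e) * w = μ * w) :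
    (u = 0 ∧ w = 0) ∨
      μ ^ 2 + ((σ + 1 : ℝ) - I * e) * μ + ((σ * (1 - r₁) : ℝ) - I * (σ * (e + r₂) : ℝ)) = 0 := by
  have hσ' : (σ : ℂ) ≠ 0 := by exact_mod_cast hσ.ne'
  by_cases hu : u = 0
  · subst hu
    left
    simpa [hσ'] using h₁
  · right
    apply (mul_eq_zero.1 _).resolve_right hu
    push_cast
    linear_combination (-(μ + 1 - I * e)) * h₁ - σ * h₂

/-- **Stability criterion for the zero equilibrium of the complex Lorenz system.**
All eigenvalues of the Jacobian matrix of the right-hand side of the complex Lorenz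
system (in real coordinates) at S₀ = (0,0,0,0,0) have negative real part if and only
if r₁ < r₁c = 1 + (e + r₂)(e − σ r₂)/(σ + 1)². -/
theorem complex_lorenz_S0_stability
    (σ b r₁ r₂ e : ℝ) (hσ : 0 < σ) (hb : 0 < b) :
    (∀ μ : ℂ, Module.End.HasEigenvalue
        (Matrix.toLin'
          (!![(-σ : ℂ), 0, (σ : ℂ), 0, 0;
              0, (-σ : ℂ), 0, (σ : ℂ), 0;
              (r₁ : ℂ), (-r₂ : ℂ), -1, (-e : ℂ), 0;
              (r₂ : ℂ), (r₁ : ℂ), (e : ℂ), -1, 0;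
              0, 0, 0, 0, (-b : ℂ)])) μ → μ.re < 0)
      ↔ r₁ < 1 + (e + r₂) * (e - σ * r₂) / (σ + 1) ^ 2 := by
  have hA : 0 < σ + 1 := by linarith
  have hσ' : (σ : ℂ) ≠ 0 := by exact_mod_cast hσ.ne'
  have hcrit : r₁ < 1 + (e + r₂) * (e - σ * r₂) / (σ + 1) ^ 2 ↔
      0 < σ * (1 - r₁) * (σ + 1) ^ 2 + e * (σ * (e + r₂)) * (σ + 1) - (σ * (e + r₂)) ^ 2 := by
    have hK : σ * (1 - r₁) * (σ + 1) ^ 2 + e * (σ * (e + r₂)) * (σ + 1) - (σ * (e + r₂)) ^ 2 =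
        σ * (σ + 1) ^ 2 * (1 + (e + r₂) * (e - σ * r₂) / (σ + 1) ^ 2 - r₁) := by
      field_simp
      ring
    rw [hK, mul_pos_iff_of_pos_left (by positivity), sub_pos]
  rw [hcrit]
  constructor
  · intro h
    by_contra! hK
    obtain ⟨μ, hμ, hre⟩ := exists_complex_quadratic_root_re_nonneg hA hK
    refine (h μ ?_).not_ge hre
    refine Module.End.hasEigenvalue_of_hasEigenvector
      (x := ![1, -I, (μ + σ) / σ, -I * ((μ + σ) / σ), 0])
      (Module.End.hasEigenvector_iff.2 ⟨Module.End.mem_eigenspace_iff.2 ?_, fun h0 => ?_⟩)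
    · have hs : (μ + 1 - I * e) * ((μ + σ) / σ) = r₁ + I * r₂ := by
        field_simp
        push_cast at hμ
        linear_combination hμ
      have hs' : σ * ((μ + σ) / σ) = μ + σ := by field_simp
      set s := (μ + σ) / σ
      ext i
      fin_cases i <;>
        simp [Matrix.toLin'_apply, Matrix.mulVec, dotProduct, Fin.sum_univ_five]
      · linear_combination hs'
      · linear_combination (-I) * hs'
      · linear_combination -hs
      · linear_combination I * hs + (r₂ + e * s) * I_sq
    · simpa using congrFun h0 0
  · intro hK μ hμ
    obtain ⟨v, hv⟩ := hμ.exists_hasEigenvector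
    have hmul := hv.apply_eq_smul
    have e0 := congrFun hmul 0
    have e1 := congrFun hmul 1
    have e2 := congrFun hmul 2
    have e3 := congrFun hmul 3
    have e4 := congrFun hmul 4
    simp [Matrix.toLin'_apply, Matrix.mulVec, dotProduct, Fin.sum_univ_five] at e0 e1 e2 e3 e4
    rcases complex_lorenz_block (r₁ := r₁) (r₂ := r₂) (e := e) hσ (μ := μ)
      (u := v 0 + I * v 1) (w := v 2 + I * v 3)
      (by linear_combination e0 + I * e1)
      (by linear_combination e2 + I * e3 + (r₂ * v 1 + e * v 3) * I_sq) with ⟨hu, hw⟩ | hroot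
    · rcases complex_lorenz_block (r₁ := r₁) (r₂ := -r₂) (e := -e) hσ (μ := μ)
        (u := v 0 - I * v 1) (w := v 2 - I * v 3)
        (by linear_combination e0 - I * e1)
        (by
          push_cast
          linear_combination e2 - I * e3 + (r₂ * v 1 + e * v 3) * I_sq) with ⟨hu', hw'⟩ | hroot
      · have h0 : v 0 = 0 := by linear_combination (hu + hu') / 2
        have h1 : v 1 = 0 := by linear_combination -I * (hu - hu') / 2 + v 1 * I_sq
        have h2 : v 2 = 0 := by linear_combination (hw + hw') / 2
        have h3 : v 3 = 0 := by linear_combination -I * (hw - hw') / 2 + v 3 * I_sq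
        have h4 : v 4 ≠ 0 := fun h4 => hv.2 (by
          ext i
          fin_cases i <;> assumption)
        have hμb : μ = -b := by
          apply mul_right_cancel₀ h4
          linear_combination -e4
        simpa [hμb] using hb
      · exact re_neg_of_complex_quadratic hA (by linarith) hroot
    · exact re_neg_of_complex_quadratic hA hK hroot
end

section
/- Consider the complex Lorenz system Ẋ = σ(Y−X), Ẏ = rX − aY − XZ, Ż = −bZ + ½(X*Y + XY*) with σ, b > 0, r = r₁ + i r₂, a = 1 − i e. If 4r₁ < −r₂², then every solution (X(t),Y(t),Z(t)) defined on [0,∞) converges to the equilibrium S₀ = (0,0,0) as t → +∞. -/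
open Filter Topology

/-- Exponential decay: a function with `W' ≤ -k W` on `[0, ∞)` lies below `W 0 * exp (-k t)`. -/
theorem le_mul_exp_of_deriv_le_neg_mul {W W' : ℝ → ℝ} {k : ℝ}
    (hW : ∀ t, 0 ≤ t → HasDerivAt W (W' t) t) (hle : ∀ t, 0 ≤ t → W' t ≤ -k * W t)
    {t : ℝ} (ht : 0 ≤ t) : W t ≤ W 0 * Real.exp (-k * t) := by
  have hd : ∀ s, 0 ≤ s → HasDerivAt (fun s => W s * Real.exp (k * s))
      (W' s * Real.exp (k * s) + W s * (Real.exp (k * s) * k)) s := fun s hs =>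
    (hW s hs).mul (by simpa using ((hasDerivAt_id s).const_mul k).exp)
  have hanti : AntitoneOn (fun s => W s * Real.exp (k * s)) (Set.Ici 0) := by
    refine antitoneOn_of_deriv_nonpos (convex_Ici 0)
      (fun s hs => (hd s hs).continuousAt.continuousWithinAt)
      (fun s hs => (hd s (interior_subset hs)).differentiableAt.differentiableWithinAt)
      (fun s hs => ?_)
    have hs0 : 0 ≤ s := interior_subset hs
    rw [(hd s hs0).deriv]
    nlinarith [hle s hs0, Real.exp_pos (k * s)]
  have h := hanti (Set.mem_Ici.2 le_rfl) (Set.mem_Ici.2 ht) ht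
  simp only [mul_zero, Real.exp_zero, mul_one] at h
  calc W t = W t * Real.exp (k * t) * Real.exp (-k * t) := by
        rw [mul_assoc, ← Real.exp_add]; simp
    _ ≤ W 0 * Real.exp (-k * t) := by gcongr

/-- A nonnegative function with `W' ≤ -k W` on `[0, ∞)`, `k > 0`, tends to zero. -/
theorem tendsto_zero_of_deriv_le_neg_mul {W W' : ℝ → ℝ} {k : ℝ} (hk : 0 < k)
    (hW : ∀ t, 0 ≤ t → HasDerivAt W (W' t) t) (hle : ∀ t, 0 ≤ t → W' t ≤ -k * W t)
    (hnonneg : ∀ t, 0 ≤ W t) : Tendsto W atTop (𝓝 0) := by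
  have hexp : Tendsto (fun t => W 0 * Real.exp (-k * t)) atTop (𝓝 0) := by
    simpa using (Real.tendsto_exp_atBot.comp
      (tendsto_id.const_mul_atTop_of_neg (neg_lt_zero.2 hk))).const_mul (W 0)
  refine squeeze_zero' (Eventually.of_forall hnonneg) ?_ hexp
  filter_upwards [eventually_ge_atTop 0] with t ht
  exact le_mul_exp_of_deriv_le_neg_mul hW hle ht

/-- A function whose squared norm is dominated by a function tending to zero tends to zero. -/
theorem tendsto_zero_of_norm_sq_le {α E : Type*} [SeminormedAddCommGroup E] {l : Filter α}
    {f : α → E} {W : α → ℝ} {C : ℝ} (hW : Tendsto W l (𝓝 0))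
    (h : ∀ t, ‖f t‖ ^ 2 ≤ C * W t) : Tendsto f l (𝓝 0) := by
  have hsq : Tendsto (fun t => √(C * W t)) l (𝓝 0) := by
    simpa using (hW.const_mul C).sqrt
  exact squeeze_zero_norm (fun t => Real.le_sqrt_of_sq_le (h t)) hsq

/-- The derivative of the squared modulus of a complex-valued function of a real variable. -/
theorem HasDerivAt.complex_normSq {f : ℝ → ℂ} {f' : ℂ} {t : ℝ} (hf : HasDerivAt f f' t) :
    HasDerivAt (fun s => Complex.normSq (f s))
      (2 * ((f t).re * f'.re + (f t).im * f'.im)) t := by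
  have hre : HasDerivAt (fun s => (f s).re) f'.re t :=
    Complex.reCLM.hasFDerivAt.comp_hasDerivAt t hf
  have him : HasDerivAt (fun s => (f s).im) f'.im t :=
    Complex.imCLM.hasFDerivAt.comp_hasDerivAt t hf
  simp only [Complex.normSq_apply]
  exact ((hre.mul hre).add (him.mul him)).congr_deriv (by ring)

/-- The quadratic form governing the dissipation of the Lyapunov function of the complex Lorenz
system is negative definite when `4 r₁ < -r₂²`; here `c = 2 - r₁`. -/
theorem lorenz_dissipation_le {c r₂ : ℝ} (hc : r₂ ^ 2 < 4 * c - 8) (x₁ x₂ y₁ y₂ : ℝ) :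
    -c * (x₁ ^ 2 + x₂ ^ 2) + x₁ * (2 * y₁ + r₂ * y₂) + x₂ * (2 * y₂ - r₂ * y₁)
        - (y₁ ^ 2 + y₂ ^ 2)
      ≤ -(1 / 2) * (x₁ ^ 2 + x₂ ^ 2) - 1 / (2 * c) * (y₁ ^ 2 + y₂ ^ 2) := by
  have hc2 : 2 < c := by nlinarith [sq_nonneg r₂]
  have young (x p : ℝ) : x * p ≤ (c - 1 / 2) * x ^ 2 + p ^ 2 / (4 * c - 2) := by
    have h : (c - 1 / 2) * x ^ 2 + p ^ 2 / (4 * c - 2) - x * p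
        = ((2 * c - 1) * x - p) ^ 2 / (4 * c - 2) := by
      have h₀ : 4 * c - 2 ≠ 0 := by linarith
      rw [eq_div_iff h₀, sub_mul, add_mul, div_mul_cancel₀ _ h₀]
      ring
    have : 0 ≤ ((2 * c - 1) * x - p) ^ 2 / (4 * c - 2) :=
      div_nonneg (sq_nonneg _) (by linarith)
    linarith
  have hcoef : (4 + r₂ ^ 2) / (4 * c - 2) ≤ 1 - 1 / (2 * c) := by
    rw [div_le_iff₀ (by linarith)]
    have h : (1 - 1 / (2 * c)) * (4 * c - 2) = 4 * c - 4 + 1 / c := by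
      field_simp
      ring
    have : 0 < 1 / c := by positivity
    linarith
  have hsum : (2 * y₁ + r₂ * y₂) ^ 2 / (4 * c - 2) + (2 * y₂ - r₂ * y₁) ^ 2 / (4 * c - 2)
      = (4 + r₂ ^ 2) / (4 * c - 2) * (y₁ ^ 2 + y₂ ^ 2) := by
    ring
  have := mul_le_mul_of_nonneg_right hcoef (by positivity : 0 ≤ y₁ ^ 2 + y₂ ^ 2)
  linarith [young x₁ (2 * y₁ + r₂ * y₂), young x₂ (2 * y₂ - r₂ * y₁)]

/-- **Global stability of S₀ for the complex Lorenz system when 4r₁ < −r₂².**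
If 4r₁ < −r₂² then every solution (X(t),Y(t),Z(t)) of the complex Lorenz system
defined on [0,∞) converges to the equilibrium S₀ = (0,0,0) as t → +∞. -/
theorem complex_lorenz_global_stability_case2
    (σ b e r₁ r₂ : ℝ) (hσ : 0 < σ) (hb : 0 < b)
    (hr : 4 * r₁ < -r₂ ^ 2)
    (X Y : ℝ → ℂ) (Z : ℝ → ℝ)
    (hX : ∀ t : ℝ, 0 ≤ t → HasDerivAt X ((σ : ℂ) * (Y t - X t)) t)
    (hY : ∀ t : ℝ, 0 ≤ t → HasDerivAt Y
      (((r₁ : ℂ) + (r₂ : ℂ) * Complex.I) * X t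
        - (1 - (e : ℂ) * Complex.I) * Y t - X t * (Z t : ℂ)) t)
    (hZ : ∀ t : ℝ, 0 ≤ t → HasDerivAt Z
      (-b * Z t + (1 / 2) * ((starRingEnd ℂ) (X t) * Y t
        + X t * (starRingEnd ℂ) (Y t)).re) t) :
    Tendsto (fun t : ℝ => ((X t, Y t, Z t) : ℂ × ℂ × ℝ))
      atTop (𝓝 ((0, 0, 0) : ℂ × ℂ × ℝ)) := by
  obtain ⟨c, rfl⟩ : ∃ c, r₁ = 2 - c := ⟨2 - r₁, by ring⟩
  have hc : 2 < c := by nlinarith [sq_nonneg r₂]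
  have hc0 : 0 < c := by linarith
  obtain ⟨k, hk, hkσ, hkc, hkb⟩ :
      ∃ k : ℝ, 0 < k ∧ k ≤ σ / (2 * c) ∧ k ≤ 1 / (2 * c) ∧ k ≤ b :=
    ⟨min (σ / (2 * c)) (min (1 / (2 * c)) b), by positivity, min_le_left _ _,
      (min_le_right _ _).trans (min_le_left _ _), (min_le_right _ _).trans (min_le_right _ _)⟩
  have hW := fun t ht => (((hX t ht).complex_normSq.const_mul (c / σ)).add
    (hY t ht).complex_normSq).add ((hZ t ht).pow 2)
  have hWlim := tendsto_zero_of_deriv_le_neg_mul (k := 2 * k) (by positivity) hW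
    (fun t _ => by
      have hdiss := lorenz_dissipation_le (c := c) (r₂ := r₂) (by linarith)
        (X t).re (X t).im (Y t).re (Y t).im
      have hx : k * (c / σ) ≤ 1 / 2 := by
        calc k * (c / σ) ≤ σ / (2 * c) * (c / σ) := by gcongr
          _ = 1 / 2 := by field_simp
      have hx' := mul_le_mul_of_nonneg_right hx
        (by positivity : 0 ≤ (X t).re ^ 2 + (X t).im ^ 2)
      have hy' := mul_le_mul_of_nonneg_right hkc
        (by positivity : 0 ≤ (Y t).re ^ 2 + (Y t).im ^ 2)
      have hz' := mul_le_mul_of_nonneg_right hkb (sq_nonneg (Z t))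
      have hcσ (u : ℝ) : c / σ * (2 * (σ * u)) = 2 * (c * u) := by field_simp
      have hXd := hcσ ((X t).re * ((Y t).re - (X t).re) + (X t).im * ((Y t).im - (X t).im))
      simp [Complex.normSq_apply]
      linarith)
    (fun t => by
      have := Complex.normSq_nonneg (X t)
      have := Complex.normSq_nonneg (Y t)
      simp only [Pi.add_apply, Pi.pow_apply]
      positivity)
  have hXlim : Tendsto X atTop (𝓝 0) := tendsto_zero_of_norm_sq_le (C := σ / c) hWlim fun t => by
    have := Complex.normSq_nonneg (Y t)
    have h : σ / c * (c / σ * Complex.normSq (X t)) = Complex.normSq (X t) := by field_simp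
    have : 0 ≤ σ / c * (Complex.normSq (Y t) + Z t ^ 2) := by positivity
    simp only [Pi.add_apply, Pi.pow_apply, ← Complex.normSq_eq_norm_sq]
    linarith
  have hYlim : Tendsto Y atTop (𝓝 0) := tendsto_zero_of_norm_sq_le (C := 1) hWlim fun t => by
    have := Complex.normSq_nonneg (X t)
    have : 0 ≤ c / σ * Complex.normSq (X t) + Z t ^ 2 := by positivity
    simp only [Pi.add_apply, Pi.pow_apply, ← Complex.normSq_eq_norm_sq]
    linarith
  have hZlim : Tendsto Z atTop (𝓝 0) := tendsto_zero_of_norm_sq_le (C := 1) hWlim fun t => by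
    have := Complex.normSq_nonneg (X t)
    have := Complex.normSq_nonneg (Y t)
    have : 0 ≤ c / σ * Complex.normSq (X t) + Complex.normSq (Y t) := by positivity
    simp only [Pi.add_apply, Pi.pow_apply, Real.norm_eq_abs, sq_abs]
    linarith
  exact hXlim.prodMk_nhds (hYlim.prodMk_nhds hZlim)
end

section
/- Let σ > 0, b > 0 and r₁, r₂ ∈ ℝ with 4r₁ < −r₂² (so in particular r₁ < 0), and set D = √(−r₁/σ). Then the quadratic form W(x₁,x₂,x₃,x₄,x₅) = −σD²(x₁² + x₂²) − (x₃² + x₄²) − r₂(x₂x₃ − x₁x₄) − b x₅² is negative definite on ℝ⁵: W(x) < 0 for every x ≠ 0. (This quadratic form is the derivative of the Lyapunov function V = ½[D²(x₁²+x₂²) + x₃² + x₄² + x₅²] along the complex Lorenz system in real coordinates.) -/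
/-- **Negative definiteness of the Lyapunov derivative (case 4r₁ < −r₂²).**
Let σ > 0, b > 0 and 4r₁ < −r₂² (so r₁ < 0), and set D = √(−r₁/σ). Then the
quadratic form W(x) = −σD²(x₁² + x₂²) − (x₃² + x₄²) − r₂(x₂x₃ − x₁x₄) − bx₅² is
negative definite on ℝ⁵. -/
theorem complex_lorenz_quadratic_form_negdef
    (σ b r₁ r₂ : ℝ) (hσ : 0 < σ) (hb : 0 < b) (hr : 4 * r₁ < -r₂ ^ 2) :
    ∀ x₁ x₂ x₃ x₄ x₅ : ℝ, (x₁, x₂, x₃, x₄, x₅) ≠ ((0 : ℝ), (0 : ℝ), (0 : ℝ), (0 : ℝ), (0 : ℝ)) →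
      -σ * (Real.sqrt (-r₁ / σ)) ^ 2 * (x₁ ^ 2 + x₂ ^ 2) - (x₃ ^ 2 + x₄ ^ 2)
        - r₂ * (x₂ * x₃ - x₁ * x₄) - b * x₅ ^ 2 < 0 := by
  intro x₁ x₂ x₃ x₄ x₅ hx
  have hr₁ : 0 ≤ -r₁ / σ := div_nonneg (by nlinarith [sq_nonneg r₂]) hσ.le
  have hD : -σ * (Real.sqrt (-r₁ / σ)) ^ 2 = r₁ := by
    rw [Real.sq_sqrt hr₁]
    field_simp
  rw [hD]
  have hc : 0 < -r₁ - r₂ ^ 2 / 4 := by linarith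
  by_contra! hW
  have h₁ := mul_nonneg hc.le (sq_nonneg x₁)
  have h₂ := mul_nonneg hc.le (sq_nonneg x₂)
  have h₃ := sq_nonneg (x₃ + r₂ * x₂ / 2)
  have h₄ := sq_nonneg (x₄ - r₂ * x₁ / 2)
  have h₅ := mul_nonneg hb.le (sq_nonneg x₅)
  have hx₁ : x₁ = 0 := by
    have h : (-r₁ - r₂ ^ 2 / 4) * x₁ ^ 2 = 0 := by linarith
    simpa [hc.ne'] using h
  have hx₂ : x₂ = 0 := by
    have h : (-r₁ - r₂ ^ 2 / 4) * x₂ ^ 2 = 0 := by linarith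
    simpa [hc.ne'] using h
  have hx₅ : x₅ = 0 := by
    have h : b * x₅ ^ 2 = 0 := by linarith
    simpa [hb.ne'] using h
  have hx₃ : x₃ = 0 := by
    have h : (x₃ + r₂ * x₂ / 2) ^ 2 = 0 := by linarith
    simpa [hx₂] using h
  have hx₄ : x₄ = 0 := by
    have h : (x₄ - r₂ * x₁ / 2) ^ 2 = 0 := by linarith
    simpa [hx₁] using h
  exact hx (by rw [hx₁, hx₂, hx₃, hx₄, hx₅])
end

section
/- Consider the complex Lorenz system Ẋ = σ(Y−X), Ẏ = rX − aY − XZ, Ż = −bZ + ½(X*Y + XY*) with σ, b > 0, r = r₁ + i r₂, a = 1 − i e. Assume 2σ > b and η := σ(r₁ − 1) − e²/4 > 0. If the system possesses a homoclinic orbit of the saddle equilibrium S₀ = (0,0,0) (a nonconstant solution u : ℝ → ℂ×ℂ×ℝ with u(t) → (0,0,0) as t → ±∞), then necessarily r₂ = e(1 − σ)/(2σ). -/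
open Filter Topology

/-- A complex number has a square root with nonnegative real part, in real coordinates. -/
lemma exists_real_coordinates_sqrt (α β : ℝ) :
    ∃ p q : ℝ, 0 ≤ p ∧ p ^ 2 - q ^ 2 = α ∧ 2 * p * q = β := by
  obtain ⟨s, hs⟩ := IsAlgClosed.exists_pow_nat_eq (⟨α, β⟩ : ℂ) (n := 2) two_pos
  have hre := congrArg Complex.re hs
  have him := congrArg Complex.im hs
  simp only [pow_two, Complex.mul_re, Complex.mul_im] at hre him
  rcases le_total 0 s.re with h | h
  · exact ⟨s.re, s.im, h, by linarith, by linarith⟩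
  · exact ⟨-s.re, -s.im, by linarith, by linarith, by linarith⟩

/-- If `g' = -c g + h` with `h ≥ 0`, then `exp (c t) g` is nondecreasing. -/
lemma monotone_exp_mul_of_hasDerivAt {g h : ℝ → ℝ} {c : ℝ}
    (hg : ∀ t, HasDerivAt g (-c * g t + h t) t) (hh : ∀ t, 0 ≤ h t) :
    Monotone fun t => Real.exp (c * t) * g t := by
  have hd : ∀ t, HasDerivAt (fun t => Real.exp (c * t) * g t) (Real.exp (c * t) * h t) t := by
    intro t
    have h1 : HasDerivAt (fun t : ℝ => Real.exp (c * t)) (Real.exp (c * t) * (c * 1)) t :=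
      ((hasDerivAt_id t).const_mul c).exp
    exact (h1.mul (hg t)).congr_deriv (by ring)
  exact monotone_of_deriv_nonneg (fun t => (hd t).differentiableAt)
    fun t => by rw [(hd t).deriv]; exact mul_nonneg (Real.exp_pos _).le (hh t)

lemma tendsto_exp_mul_atBot_zero {g : ℝ → ℝ} {c : ℝ} (hc : 0 < c)
    (hg : Tendsto g atBot (𝓝 0)) :
    Tendsto (fun t => Real.exp (c * t) * g t) atBot (𝓝 0) := by
  have h : Tendsto (fun t : ℝ => Real.exp (c * t)) atBot (𝓝 0) :=
    Real.tendsto_exp_atBot.comp (tendsto_id.const_mul_atBot hc)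
  simpa using h.mul hg

/-- If `g' = -c g + h` with `c > 0`, `h ≥ 0` and `g → 0` at `-∞`, then `g ≥ 0`. -/
lemma nonneg_of_hasDerivAt_of_tendsto_atBot {g h : ℝ → ℝ} {c : ℝ} (hc : 0 < c)
    (hg : ∀ t, HasDerivAt g (-c * g t + h t) t) (hh : ∀ t, 0 ≤ h t)
    (hlim : Tendsto g atBot (𝓝 0)) (t : ℝ) : 0 ≤ g t := by
  have := (monotone_exp_mul_of_hasDerivAt hg hh).le_of_tendsto
    (tendsto_exp_mul_atBot_zero hc hlim) t
  exact nonneg_of_mul_nonneg_right this (Real.exp_pos _)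

/-- If `g' = -c g + h` with `c > 0`, `h ≥ 0`, `g → 0` at `-∞` and `g` vanishes at all late times,
then `h` vanishes identically. -/
lemma eq_zero_of_hasDerivAt_of_eventually_eq_zero {g h : ℝ → ℝ} {c : ℝ} (hc : 0 < c)
    (hg : ∀ t, HasDerivAt g (-c * g t + h t) t) (hh : ∀ t, 0 ≤ h t)
    (hlim : Tendsto g atBot (𝓝 0)) (hev : ∀ᶠ t in atTop, g t = 0) (t : ℝ) : h t = 0 := by
  have hnn := nonneg_of_hasDerivAt_of_tendsto_atBot hc hg hh hlim
  have hzero : ∀ t, g t = 0 := by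
    intro t
    obtain ⟨s, hs, hts⟩ := (hev.and (eventually_ge_atTop t)).exists
    have hm : Real.exp (c * t) * g t ≤ Real.exp (c * s) * g s :=
      monotone_exp_mul_of_hasDerivAt hg hh hts
    rw [hs, mul_zero] at hm
    exact le_antisymm (nonpos_of_mul_nonpos_right hm (Real.exp_pos _)) (hnn t)
  have hd : HasDerivAt g 0 t := by
    rw [funext hzero]
    exact hasDerivAt_const t 0
  have := (hg t).unique hd
  rwa [hzero, mul_zero, zero_add] at this

/-- A function with eventually nonnegative derivative tending to `0` at `+∞` is eventually
nonpositive. -/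
lemma eventually_nonpos_of_hasDerivAt {Q Q' : ℝ → ℝ} (hQ : ∀ t, HasDerivAt Q (Q' t) t)
    (hev : ∀ᶠ t in atTop, 0 ≤ Q' t) (hlim : Tendsto Q atTop (𝓝 0)) :
    ∀ᶠ t in atTop, Q t ≤ 0 := by
  obtain ⟨T, hT⟩ := eventually_atTop.1 hev
  have hmono : MonotoneOn Q (Set.Ici T) := by
    refine monotoneOn_of_deriv_nonneg (convex_Ici T)
      (fun t _ => (hQ t).continuousAt.continuousWithinAt)
      (fun t _ => (hQ t).differentiableAt.differentiableWithinAt) fun t ht => ?_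
    rw [interior_Ici] at ht
    rw [(hQ t).deriv]
    exact hT t (le_of_lt ht)
  filter_upwards [eventually_ge_atTop T] with t ht
  refine ge_of_tendsto hlim ?_
  filter_upwards [eventually_ge_atTop t] with s hs
  exact hmono ht (le_trans ht hs) hs

lemma eq_zero_of_sq_add_sq_nonpos {a b : ℝ} (h : a ^ 2 + b ^ 2 ≤ 0) : a = 0 ∧ b = 0 :=
  ⟨pow_eq_zero_iff two_ne_zero |>.1 (by linarith [sq_nonneg a, sq_nonneg b]),
    pow_eq_zero_iff two_ne_zero |>.1 (by linarith [sq_nonneg a, sq_nonneg b])⟩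

/-- In the plane, if `m |x|² ≤ κ (x × P)` then `m |⟨P, x⟩| ≤ |κ| |P|²`. -/
lemma mul_abs_inner_le_of_cross {m κ x₁ x₂ P₁ P₂ : ℝ} (hm : 0 < m)
    (h : m * (x₁ ^ 2 + x₂ ^ 2) ≤ κ * (x₁ * P₂ - x₂ * P₁)) :
    m * |P₁ * x₁ + P₂ * x₂| ≤ |κ| * (P₁ ^ 2 + P₂ ^ 2) := by
  set A := x₁ ^ 2 + x₂ ^ 2 with hA
  set Q := P₁ ^ 2 + P₂ ^ 2 with hQ
  have hA0 : 0 ≤ A := by positivity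
  have hQ0 : 0 ≤ Q := by positivity
  have hcross : (x₁ * P₂ - x₂ * P₁) ^ 2 ≤ A * Q := by
    nlinarith [sq_nonneg (P₁ * x₁ + P₂ * x₂)]
  have hinner : (P₁ * x₁ + P₂ * x₂) ^ 2 ≤ A * Q := by
    nlinarith [sq_nonneg (x₁ * P₂ - x₂ * P₁)]
  have hsq : (m * A) ^ 2 ≤ κ ^ 2 * (A * Q) := by
    calc (m * A) ^ 2 ≤ (κ * (x₁ * P₂ - x₂ * P₁)) ^ 2 :=
          pow_le_pow_left₀ (by positivity) h 2
      _ = κ ^ 2 * (x₁ * P₂ - x₂ * P₁) ^ 2 := by ring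
      _ ≤ κ ^ 2 * (A * Q) := by gcongr
  have hAQ : m ^ 2 * A ≤ κ ^ 2 * Q := by
    rcases hA0.eq_or_lt with h0 | h0
    · rw [← h0]
      simpa using by positivity
    · refine le_of_mul_le_mul_left ?_ h0
      linarith
  refine abs_le_of_sq_le_sq' ?_ (by positivity) |>.2
  rw [mul_pow, sq_abs, mul_pow, sq_abs]
  calc m ^ 2 * (P₁ * x₁ + P₂ * x₂) ^ 2 ≤ m ^ 2 * (A * Q) := by gcongr
    _ = (m ^ 2 * A) * Q := by ring
    _ ≤ (κ ^ 2 * Q) * Q := by gcongr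
    _ = κ ^ 2 * Q ^ 2 := by ring

/-- A solution of the complex Lorenz system in real coordinates `X = x₁ + i x₂`, `Y = y₁ + i y₂`
that is homoclinic to the origin has `X = 0`, unless the parameters are balanced. -/
lemma complex_lorenz_homoclinic_eq_zero
    {σ e r₁ r₂ : ℝ} (hσ : 0 < σ) (hη : 0 < σ * (r₁ - 1) - e ^ 2 / 4)
    (hκ : σ * r₂ + (σ - 1) * e / 2 ≠ 0) {x₁ x₂ y₁ y₂ z : ℝ → ℝ}
    (hx₁ : ∀ t, HasDerivAt x₁ (σ * (y₁ t - x₁ t)) t)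
    (hx₂ : ∀ t, HasDerivAt x₂ (σ * (y₂ t - x₂ t)) t)
    (hy₁ : ∀ t, HasDerivAt y₁
      (r₁ * x₁ t - r₂ * x₂ t - y₁ t - e * y₂ t - x₁ t * z t) t)
    (hy₂ : ∀ t, HasDerivAt y₂
      (r₁ * x₂ t + r₂ * x₁ t - y₂ t + e * y₁ t - x₂ t * z t) t)
    (tx₁ : Tendsto x₁ atTop (𝓝 0)) (tx₂ : Tendsto x₂ atTop (𝓝 0))
    (ty₁ : Tendsto y₁ atTop (𝓝 0)) (ty₂ : Tendsto y₂ atTop (𝓝 0))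
    (tz : Tendsto z atTop (𝓝 0))
    (bx₁ : Tendsto x₁ atBot (𝓝 0)) (bx₂ : Tendsto x₂ atBot (𝓝 0))
    (by₁ : Tendsto y₁ atBot (𝓝 0)) (by₂ : Tendsto y₂ atBot (𝓝 0)) (t : ℝ) :
    x₁ t = 0 ∧ x₂ t = 0 := by
  set κ := σ * r₂ + (σ - 1) * e / 2 with hκdef
  obtain ⟨p, q, hp0, hpq, hpqκ⟩ := exists_real_coordinates_sqrt
    ((σ + 1) ^ 2 + 4 * (σ * (r₁ - 1) - e ^ 2 / 4)) (4 * κ)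
  have hp : σ + 1 < p := by
    refine lt_of_pow_lt_pow_left₀ 2 hp0 ?_
    nlinarith [sq_nonneg q]
  have hq : q ≠ 0 := by
    rintro rfl
    exact hκ (by linarith)
  set m := κ * q / 2 with hmdef
  have hm : 0 < m := by
    have : m = p * q ^ 2 / 4 := by rw [hmdef]; linear_combination -(q / 8) * hpqκ
    rw [this]
    have : 0 < p := by linarith
    positivity
  let J : ℝ → ℝ := fun t => κ * (σ * (x₁ t * y₂ t - x₂ t * y₁ t) - e / 2 * (x₁ t ^ 2 + x₂ t ^ 2))
  have hJ : ∀ t, HasDerivAt J (-(σ + 1) * J t + κ ^ 2 * (x₁ t ^ 2 + x₂ t ^ 2)) t := by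
    intro t
    refine ((((((hx₁ t).mul (hy₂ t)).sub ((hx₂ t).mul (hy₁ t))).const_mul σ).sub
      ((((hx₁ t).pow 2).add ((hx₂ t).pow 2)).const_mul (e / 2))).const_mul κ).congr_deriv ?_
    simp only [J, hκdef]
    push_cast
    ring
  have hJlim : Tendsto J atBot (𝓝 0) := by
    simpa [J] using (((((bx₁.mul by₂).sub (bx₂.mul by₁)).const_mul σ).sub
      (((bx₁.pow 2).add (bx₂.pow 2)).const_mul (e / 2))).const_mul κ)
  have hc : 0 < σ + 1 := by linarith
  have hA : ∀ t, 0 ≤ κ ^ 2 * (x₁ t ^ 2 + x₂ t ^ 2) := fun t => by positivity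
  have hJnn := nonneg_of_hasDerivAt_of_tendsto_atBot hc hJ hA hJlim
  let P₁ : ℝ → ℝ := fun t =>
    σ * (y₁ t - x₁ t) + (σ + 1 + p) / 2 * x₁ t + (e - q) / 2 * x₂ t
  let P₂ : ℝ → ℝ := fun t =>
    σ * (y₂ t - x₂ t) + (σ + 1 + p) / 2 * x₂ t - (e - q) / 2 * x₁ t
  have hQ : ∀ t, HasDerivAt (fun t => P₁ t ^ 2 + P₂ t ^ 2)
      ((p - (σ + 1)) * (P₁ t ^ 2 + P₂ t ^ 2)
        - 2 * σ * z t * (P₁ t * x₁ t + P₂ t * x₂ t)) t := by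
    intro t
    have h₁ : HasDerivAt P₁ _ t := ((((hy₁ t).sub (hx₁ t)).const_mul σ).add
      ((hx₁ t).const_mul ((σ + 1 + p) / 2))).add ((hx₂ t).const_mul ((e - q) / 2))
    have h₂ : HasDerivAt P₂ _ t := ((((hy₂ t).sub (hx₂ t)).const_mul σ).add
      ((hx₂ t).const_mul ((σ + 1 + p) / 2))).sub ((hx₁ t).const_mul ((e - q) / 2))
    have e₁ : HasDerivAt P₁ ((p - (σ + 1)) / 2 * P₁ t - (e + q) / 2 * P₂ t
        - σ * z t * x₁ t) t := by
      refine h₁.congr_deriv ?_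
      simp only [P₁, P₂]
      linear_combination -(x₁ t / 4) * hpq + (x₂ t / 4) * hpqκ + x₂ t * hκdef
    have e₂ : HasDerivAt P₂ ((p - (σ + 1)) / 2 * P₂ t + (e + q) / 2 * P₁ t
        - σ * z t * x₂ t) t := by
      refine h₂.congr_deriv ?_
      simp only [P₁, P₂]
      linear_combination -(x₂ t / 4) * hpq - (x₁ t / 4) * hpqκ - x₁ t * hκdef
    refine ((e₁.pow 2).add (e₂.pow 2)).congr_deriv ?_
    push_cast
    ring
  have hQlim : Tendsto (fun t => P₁ t ^ 2 + P₂ t ^ 2) atTop (𝓝 0) := by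
    simpa [P₁, P₂] using
      ((((ty₁.sub tx₁).const_mul σ).add (tx₁.const_mul ((σ + 1 + p) / 2))).add
        (tx₂.const_mul ((e - q) / 2))).pow 2 |>.add
      (((((ty₂.sub tx₂).const_mul σ).add (tx₂.const_mul ((σ + 1 + p) / 2))).sub
        (tx₁.const_mul ((e - q) / 2))).pow 2)
  have hcross : ∀ t, m * (x₁ t ^ 2 + x₂ t ^ 2) ≤ κ * (x₁ t * P₂ t - x₂ t * P₁ t) := by
    intro t
    have : κ * (x₁ t * P₂ t - x₂ t * P₁ t) = J t + m * (x₁ t ^ 2 + x₂ t ^ 2) := by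
      simp only [P₁, P₂, J, hmdef]
      ring
    linarith [hJnn t]
  have hzsmall : ∀ᶠ t in atTop, 2 * σ * |z t| * |κ| < (p - (σ + 1)) * m := by
    have : Tendsto (fun t => 2 * σ * |z t| * |κ|) atTop (𝓝 0) := by
      simpa using (tz.abs.const_mul (2 * σ)).mul_const |κ|
    exact this.eventually_lt_const (mul_pos (by linarith) hm)
  have hQ' : ∀ᶠ t in atTop, 0 ≤ (p - (σ + 1)) * (P₁ t ^ 2 + P₂ t ^ 2)
        - 2 * σ * z t * (P₁ t * x₁ t + P₂ t * x₂ t) := by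
    filter_upwards [hzsmall] with t ht
    have hQ0 : 0 ≤ P₁ t ^ 2 + P₂ t ^ 2 := by positivity
    have hin := mul_abs_inner_le_of_cross hm (hcross t)
    rw [sub_nonneg]
    refine le_of_mul_le_mul_left ?_ hm
    calc m * (2 * σ * z t * (P₁ t * x₁ t + P₂ t * x₂ t))
        = 2 * σ * m * (z t * (P₁ t * x₁ t + P₂ t * x₂ t)) := by ring
      _ ≤ 2 * σ * m * (|z t| * |P₁ t * x₁ t + P₂ t * x₂ t|) := by
          rw [← abs_mul]
          gcongr
          exact le_abs_self _
      _ = 2 * σ * |z t| * (m * |P₁ t * x₁ t + P₂ t * x₂ t|) := by ring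
      _ ≤ 2 * σ * |z t| * (|κ| * (P₁ t ^ 2 + P₂ t ^ 2)) := by gcongr
      _ = 2 * σ * |z t| * |κ| * (P₁ t ^ 2 + P₂ t ^ 2) := by ring
      _ ≤ (p - (σ + 1)) * m * (P₁ t ^ 2 + P₂ t ^ 2) := by gcongr
      _ = m * ((p - (σ + 1)) * (P₁ t ^ 2 + P₂ t ^ 2)) := by ring
  have hJev : ∀ᶠ t in atTop, J t = 0 := by
    filter_upwards [eventually_nonpos_of_hasDerivAt hQ hQ' hQlim] with t ht
    obtain ⟨h₁, h₂⟩ := eq_zero_of_sq_add_sq_nonpos ht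
    have h := hcross t
    rw [h₁, h₂] at h
    have hx : x₁ t ^ 2 + x₂ t ^ 2 ≤ 0 := by
      refine nonpos_of_mul_nonpos_right ?_ hm
      linarith
    obtain ⟨hx1, hx2⟩ := eq_zero_of_sq_add_sq_nonpos hx
    simp [J, hx1, hx2]
  have hfin := eq_zero_of_hasDerivAt_of_eventually_eq_zero hc hJ hA hJlim hJev t
  have hx : x₁ t ^ 2 + x₂ t ^ 2 = 0 := by simpa [hκ] using hfin
  exact eq_zero_of_sq_add_sq_nonpos hx.le

/-- **Necessary condition for a homoclinic orbit of the complex Lorenz system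
(Vladimirov).** Assume 2σ > b and η = σ(r₁−1) − e²/4 > 0. If the complex Lorenz
system possesses a homoclinic orbit of the saddle equilibrium S₀ = (0,0,0), then
necessarily r₂ = e(1−σ)/(2σ). -/
theorem complex_lorenz_homoclinic_necessary
    (σ b e r₁ r₂ : ℝ) (hσ : 0 < σ) (hb : 0 < b)
    (h2σ : b < 2 * σ) (hη : 0 < σ * (r₁ - 1) - e ^ 2 / 4)
    (u : ℝ → ℂ × ℂ × ℝ)
    (hode : ∀ t : ℝ, HasDerivAt u
      (((σ : ℂ) * ((u t).2.1 - (u t).1),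
        ((r₁ : ℂ) + (r₂ : ℂ) * Complex.I) * (u t).1
          - (1 - (e : ℂ) * Complex.I) * (u t).2.1 - (u t).1 * ((u t).2.2 : ℂ),
        -b * (u t).2.2 + (1 / 2) * ((starRingEnd ℂ) (u t).1 * (u t).2.1
          + (u t).1 * (starRingEnd ℂ) (u t).2.1).re) : ℂ × ℂ × ℝ) t)
    (hnonconst : ∃ t s : ℝ, u t ≠ u s)
    (htop : Tendsto u atTop (𝓝 ((0, 0, 0) : ℂ × ℂ × ℝ)))
    (hbot : Tendsto u atBot (𝓝 ((0, 0, 0) : ℂ × ℂ × ℝ))) :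
    r₂ = e * (1 - σ) / (2 * σ) := by
  by_contra hne
  have hX : ∀ t, HasDerivAt (fun s => (u s).1) _ t := fun t =>
    (ContinuousLinearMap.fst ℝ ℂ (ℂ × ℝ)).hasFDerivAt.comp_hasDerivAt t (hode t)
  have hYZ : ∀ t, HasDerivAt (fun s => (u s).2) _ t := fun t =>
    (ContinuousLinearMap.snd ℝ ℂ (ℂ × ℝ)).hasFDerivAt.comp_hasDerivAt t (hode t)
  have hY : ∀ t, HasDerivAt (fun s => (u s).2.1) _ t := fun t =>
    (ContinuousLinearMap.fst ℝ ℂ ℝ).hasFDerivAt.comp_hasDerivAt t (hYZ t)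
  have hZ : ∀ t, HasDerivAt (fun s => (u s).2.2) _ t := fun t =>
    (ContinuousLinearMap.snd ℝ ℂ ℝ).hasFDerivAt.comp_hasDerivAt t (hYZ t)
  have hre : ∀ {f : ℝ → ℂ} {f' : ℂ} {t : ℝ}, HasDerivAt f f' t →
      HasDerivAt (fun s => (f s).re) f'.re t := fun {f f' t} h =>
    Complex.reCLM.hasFDerivAt.comp_hasDerivAt t h
  have him : ∀ {f : ℝ → ℂ} {f' : ℂ} {t : ℝ}, HasDerivAt f f' t →
      HasDerivAt (fun s => (f s).im) f'.im t := fun {f f' t} h =>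
    Complex.imCLM.hasFDerivAt.comp_hasDerivAt t h
  have hlim : ∀ {l : Filter ℝ}, Tendsto u l (𝓝 ((0, 0, 0) : ℂ × ℂ × ℝ)) →
      Tendsto (fun t => (u t).1.re) l (𝓝 0) ∧ Tendsto (fun t => (u t).1.im) l (𝓝 0) ∧
      Tendsto (fun t => (u t).2.1.re) l (𝓝 0) ∧ Tendsto (fun t => (u t).2.1.im) l (𝓝 0) ∧
      Tendsto (fun t => (u t).2.2) l (𝓝 0) := by
    intro l h
    exact ⟨(Complex.continuous_re.tendsto _).comp h.fst_nhds,
      (Complex.continuous_im.tendsto _).comp h.fst_nhds,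
      (Complex.continuous_re.tendsto _).comp h.snd_nhds.fst_nhds,
      (Complex.continuous_im.tendsto _).comp h.snd_nhds.fst_nhds, h.snd_nhds.snd_nhds⟩
  obtain ⟨tx₁, tx₂, ty₁, ty₂, tz⟩ := hlim htop
  obtain ⟨bx₁, bx₂, by₁, by₂, bz⟩ := hlim hbot
  have hκ : σ * r₂ + (σ - 1) * e / 2 ≠ 0 := by
    intro h
    apply hne
    rw [eq_div_iff (by positivity)]
    linarith
  have hX0 : ∀ t, (u t).1 = 0 := by
    intro t
    have := complex_lorenz_homoclinic_eq_zero hσ hη hκ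
      (x₁ := fun t => (u t).1.re) (x₂ := fun t => (u t).1.im)
      (y₁ := fun t => (u t).2.1.re) (y₂ := fun t => (u t).2.1.im) (z := fun t => (u t).2.2)
      (fun t => by convert hre (hX t) using 1; simp)
      (fun t => by convert him (hX t) using 1; simp)
      (fun t => by convert hre (hY t) using 1; simp; ring)
      (fun t => by convert him (hY t) using 1; simp; ring)
      tx₁ tx₂ ty₁ ty₂ tz bx₁ bx₂ by₁ by₂ t
    exact Complex.ext this.1 this.2
  have hY0 : ∀ t, (u t).2.1 = 0 := by
    intro t
    have hd : HasDerivAt (fun s => (u s).1) 0 t := by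
      rw [funext hX0]
      exact hasDerivAt_const t 0
    simpa [hX0, hσ.ne'] using (hX t).unique hd
  have hZd : ∀ t, HasDerivAt (fun s => (u s).2.2) (-b * (u t).2.2 + 0) t := by
    intro t
    convert hZ t using 1
    simp [hX0]
  have hZd' : ∀ t, HasDerivAt (fun s => -(u s).2.2) (-b * -(u t).2.2 + 0) t := by
    intro t
    exact (hZd t).neg.congr_deriv (by ring)
  have hZ0 : ∀ t, (u t).2.2 = 0 := by
    intro t
    have h₁ := nonneg_of_hasDerivAt_of_tendsto_atBot hb hZd (fun _ => le_rfl) bz t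
    have h₂ := nonneg_of_hasDerivAt_of_tendsto_atBot hb hZd' (fun _ => le_rfl)
      (by simpa using bz.neg) t
    linarith
  obtain ⟨t, s, hts⟩ := hnonconst
  exact hts (Prod.ext (by rw [hX0, hX0])
    (Prod.ext (by rw [hY0, hY0]) (by rw [hZ0, hZ0])))
end

section
/- Consider the complex Lorenz system Ẋ = σ(Y−X), Ẏ = rX − aY − XZ, Ż = −bZ + ½(X*Y + XY*) with σ, b > 0, r = r₁ + i r₂, a = 1 − i e, in the laser case e = −r₂. Assume 2σ > b and σ(r₁ − 1) − e²/4 > 0. If the system possesses a homoclinic orbit of the equilibrium S₀ = (0,0,0), then e = r₂ = 0. -/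
open Filter Topology

/-- Moments `N = |x|²`, `p = Re (x̄ ẋ)`, `D = |ẋ|²`, `w = Im (x̄ ẋ)` of a solution of
`ẍ + c ẋ + (-η + ζ + κ i) x = 0` that decays at both ends: if `κ ≠ 0`, then `N` vanishes. -/
lemma moments_eq_zero_of_homoclinic {c η κ : ℝ} (hc : 0 < c) (hη : 0 < η) (hκ : κ ≠ 0)
    {N p D w ζ : ℝ → ℝ}
    (hN : ∀ t, HasDerivAt N (2 * p t) t)
    (hp : ∀ t, HasDerivAt p (D t - c * p t + (η - ζ t) * N t) t)
    (hw : ∀ t, HasDerivAt w (-c * w t - κ * N t) t)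
    (hN0 : ∀ t, 0 ≤ N t) (hD0 : ∀ t, 0 ≤ D t)
    (hsq : ∀ t, c * |w t| ≤ D t + c * p t + c ^ 2 / 2 * N t)
    (hζtop : Tendsto ζ atTop (𝓝 0)) (hNtop : Tendsto N atTop (𝓝 0))
    (hptop : Tendsto p atTop (𝓝 0)) (hwbot : Tendsto w atBot (𝓝 0)) (t : ℝ) : N t = 0 := by
  have hE : ∀ t, HasDerivAt (fun t => Real.exp (c * t)) (Real.exp (c * t) * c) t := fun t => by
    simpa using ((hasDerivAt_id t).const_mul c).exp
  have hEbot : Tendsto (fun t => Real.exp (c * t)) atBot (𝓝 0) :=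
    Real.tendsto_exp_atBot.comp (tendsto_id.const_mul_atBot hc)
  -- the weighted angular momentum is monotone and vanishes at `-∞`
  have hG : ∀ t, HasDerivAt (fun t => κ * (Real.exp (c * t) * w t))
      (-(κ ^ 2 * (Real.exp (c * t) * N t))) t := fun t => by
    refine HasDerivAt.congr_deriv (((hE t).mul (hw t)).const_mul κ) ?_
    ring
  have hGanti : Antitone (fun t => κ * (Real.exp (c * t) * w t)) := by
    refine antitone_of_hasDerivAt_nonpos hG fun t => ?_
    have := hN0 t
    simp only [Pi.zero_apply, Left.neg_nonpos_iff]
    positivity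
  have hGbot : Tendsto (fun t => κ * (Real.exp (c * t) * w t)) atBot (𝓝 0) := by
    simpa using (hEbot.mul hwbot).const_mul κ
  have hGle : ∀ t, κ * (Real.exp (c * t) * w t) ≤ 0 := fun t => hGanti.ge_of_tendsto hGbot t
  obtain ⟨T, hT⟩ := eventually_atTop.1 (hζtop.eventually (gt_mem_nhds hη))
  -- the derivative of `N` along with its damping correction is nonpositive near `+∞`
  have hf : ∀ t, HasDerivAt (fun t => p t + c / 2 * N t) (D t + (η - ζ t) * N t) t := fun t => by
    refine HasDerivAt.congr_deriv ((hp t).add ((hN t).const_mul (c / 2))) ?_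
    ring
  have hfmono : MonotoneOn (fun t => p t + c / 2 * N t) (Set.Ici T) := by
    refine monotoneOn_of_hasDerivWithinAt_nonneg (convex_Ici T)
      (fun t _ => (hf t).continuousAt.continuousWithinAt)
      (fun t _ => (hf t).hasDerivWithinAt) fun t ht => ?_
    rw [interior_Ici] at ht
    have h1 := hT t (le_of_lt ht)
    have := mul_nonneg (sub_nonneg.2 h1.le) (hN0 t)
    linarith [hD0 t]
  have hftop : Tendsto (fun t => p t + c / 2 * N t) atTop (𝓝 0) := by
    simpa using hptop.add (hNtop.const_mul (c / 2))
  have hfle : ∀ t, T ≤ t → p t + c / 2 * N t ≤ 0 := fun t ht =>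
    ge_of_tendsto hftop (eventually_atTop.2 ⟨t, fun s hs => hfmono ht (ht.trans hs) hs⟩)
  have hGzero : ∀ t, κ * (Real.exp (c * t) * w t) = 0 := by
    by_contra! h
    obtain ⟨t₀, h₀⟩ := h
    have h₀' := lt_of_le_of_ne (hGle t₀) h₀
    have hκ' : 0 < |κ| := abs_pos.2 hκ
    set δ := c * (-(κ * (Real.exp (c * t₀) * w t₀)) / |κ|) with hδ
    have hδ0 : 0 < δ := mul_pos hc (div_pos (neg_pos.2 h₀') hκ')
    set S := max T t₀
    have hF : ∀ t, HasDerivAt (fun t => Real.exp (c * t) * (p t + c / 2 * N t) - δ * t)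
        (Real.exp (c * t) * (D t + c * p t + c ^ 2 / 2 * N t + (η - ζ t) * N t) - δ) t :=
      fun t => by
        refine HasDerivAt.congr_deriv (((hE t).mul (hf t)).sub ((hasDerivAt_id t).const_mul δ)) ?_
        ring
    have hFmono : MonotoneOn (fun t => Real.exp (c * t) * (p t + c / 2 * N t) - δ * t)
        (Set.Ici S) := by
      refine monotoneOn_of_hasDerivWithinAt_nonneg (convex_Ici S)
        (fun t _ => (hF t).continuousAt.continuousWithinAt)
        (fun t _ => (hF t).hasDerivWithinAt) fun t ht => ?_
      rw [interior_Ici] at ht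
      have hSt : S ≤ t := le_of_lt ht
      have h1 := hT t ((le_max_left _ _).trans hSt)
      have h2 : κ * (Real.exp (c * t) * w t) ≤ κ * (Real.exp (c * t₀) * w t₀) :=
        hGanti ((le_max_right _ _).trans hSt)
      have h3 : -(κ * (Real.exp (c * t) * w t)) ≤ |κ| * (Real.exp (c * t) * |w t|) := by
        have := neg_abs_le (κ * (Real.exp (c * t) * w t))
        rw [abs_mul, abs_mul, Real.abs_exp] at this
        linarith
      have h4 : δ ≤ c * (Real.exp (c * t) * |w t|) := by
        refine mul_le_mul_of_nonneg_left ?_ hc.le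
        rw [div_le_iff₀ hκ']
        linarith
      have h5 : Real.exp (c * t) * (c * |w t|) ≤ Real.exp (c * t) *
          (D t + c * p t + c ^ 2 / 2 * N t + (η - ζ t) * N t) := by
        refine mul_le_mul_of_nonneg_left ?_ (Real.exp_pos _).le
        have := mul_nonneg (sub_nonneg.2 h1.le) (hN0 t)
        linarith [hsq t]
      linarith
    have hbound : ∀ t, S ≤ t →
        Real.exp (c * S) * (p S + c / 2 * N S) - δ * S ≤ -(δ * t) := fun t ht => by
      have h1 := hFmono (Set.mem_Ici.2 le_rfl) ht ht
      have h2 := mul_nonpos_of_nonneg_of_nonpos (Real.exp_pos (c * t)).le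
        (hfle t ((le_max_left _ _).trans ht))
      simp only at h1
      linarith
    have htop : Tendsto (fun t => δ * t) atTop atTop := tendsto_id.const_mul_atTop hδ0
    obtain ⟨t, ht, ht'⟩ := ((eventually_ge_atTop S).and (htop.eventually_gt_atTop
      (-(Real.exp (c * S) * (p S + c / 2 * N S) - δ * S)))).exists
    linarith [hbound t ht]
  have h := hG t
  rw [funext hGzero] at h
  have h' := h.unique (hasDerivAt_const t (0 : ℝ))
  simpa [hκ, Real.exp_ne_zero] using h'

/-- A solution of `ż = -b z` with `b > 0` that tends to `0` at `-∞` vanishes. -/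
lemma eq_zero_of_hasDerivAt_neg_mul_of_tendsto_atBot {b : ℝ} (hb : 0 < b) {z : ℝ → ℝ}
    (hz : ∀ t, HasDerivAt z (-b * z t) t) (hbot : Tendsto z atBot (𝓝 0)) (t : ℝ) : z t = 0 := by
  have hE : ∀ t, HasDerivAt (fun t => Real.exp (b * t)) (Real.exp (b * t) * b) t := fun t => by
    simpa using ((hasDerivAt_id t).const_mul b).exp
  have hEbot : Tendsto (fun t => Real.exp (b * t)) atBot (𝓝 0) :=
    Real.tendsto_exp_atBot.comp (tendsto_id.const_mul_atBot hb)
  have hG : ∀ t, HasDerivAt (fun t => Real.exp (b * t) * z t) 0 t := fun t => by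
    refine HasDerivAt.congr_deriv ((hE t).mul (hz t)) ?_
    ring
  have hconst : ∀ s, Real.exp (b * s) * z s = Real.exp (b * t) * z t := fun s =>
    is_const_of_deriv_eq_zero (fun s => (hG s).differentiableAt) (fun s => (hG s).deriv) s t
  have hlim : Tendsto (fun s => Real.exp (b * s) * z s) atBot (𝓝 0) := by
    simpa using hEbot.mul hbot
  rw [funext hconst] at hlim
  simpa [Real.exp_ne_zero] using tendsto_nhds_unique tendsto_const_nhds hlim

/-- **Homoclinic orbits in the laser case (e = −r₂).**
Assume 2σ > b and σ(r₁−1) − e²/4 > 0, in the laser case e = −r₂. If the complex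
Lorenz system possesses a homoclinic orbit of the equilibrium S₀ = (0,0,0), then
e = r₂ = 0. -/
theorem complex_lorenz_homoclinic_laser_case
    (σ b e r₁ r₂ : ℝ) (hσ : 0 < σ) (hb : 0 < b)
    (hlaser : e = -r₂)
    (h2σ : b < 2 * σ) (hη : 0 < σ * (r₁ - 1) - e ^ 2 / 4)
    (u : ℝ → ℂ × ℂ × ℝ)
    (hode : ∀ t : ℝ, HasDerivAt u
      (((σ : ℂ) * ((u t).2.1 - (u t).1),
        ((r₁ : ℂ) + (r₂ : ℂ) * Complex.I) * (u t).1
          - (1 - (e : ℂ) * Complex.I) * (u t).2.1 - (u t).1 * ((u t).2.2 : ℂ),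
        -b * (u t).2.2 + (1 / 2) * ((starRingEnd ℂ) (u t).1 * (u t).2.1
          + (u t).1 * (starRingEnd ℂ) (u t).2.1).re) : ℂ × ℂ × ℝ) t)
    (hnonconst : ∃ t s : ℝ, u t ≠ u s)
    (htop : Tendsto u atTop (𝓝 ((0, 0, 0) : ℂ × ℂ × ℝ)))
    (hbot : Tendsto u atBot (𝓝 ((0, 0, 0) : ℂ × ℂ × ℝ))) :
    e = 0 ∧ r₂ = 0 := by
  have hX : ∀ t, HasDerivAt (fun t => (u t).1) ((σ : ℂ) * ((u t).2.1 - (u t).1)) t :=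
    fun t => (hode t).fst
  have hY : ∀ t, HasDerivAt (fun t => (u t).2.1) (((r₁ : ℂ) + (r₂ : ℂ) * Complex.I) * (u t).1
      - (1 - (e : ℂ) * Complex.I) * (u t).2.1 - (u t).1 * ((u t).2.2 : ℂ)) t :=
    fun t => (hode t).snd.fst
  have hZ : ∀ t, HasDerivAt (fun t => (u t).2.2)
      (-b * (u t).2.2 + (1 / 2) * ((starRingEnd ℂ) (u t).1 * (u t).2.1
          + (u t).1 * (starRingEnd ℂ) (u t).2.1).re) t :=
    fun t => (hode t).snd.snd
  have hre : ∀ {f : ℝ → ℂ} {f' : ℂ} {t : ℝ}, HasDerivAt f f' t →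
      HasDerivAt (fun t => (f t).re) f'.re t := fun h =>
    Complex.reCLM.hasFDerivAt.comp_hasDerivAt _ h
  have him : ∀ {f : ℝ → ℂ} {f' : ℂ} {t : ℝ}, HasDerivAt f f' t →
      HasDerivAt (fun t => (f t).im) f'.im t := fun h =>
    Complex.imCLM.hasFDerivAt.comp_hasDerivAt _ h
  have hlim : ∀ {l : Filter ℝ} (F : ℂ × ℂ × ℝ → ℝ), Continuous F → F (0, 0, 0) = 0 →
      Tendsto u l (𝓝 (0, 0, 0)) → Tendsto (fun t => F (u t)) l (𝓝 0) :=
    fun F hF h0 hl => h0 ▸ (hF.tendsto _).comp hl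
  by_contra hne
  have he : e ≠ 0 := fun h => hne ⟨h, by linarith⟩
  -- components of `ẋ`, where `X = x exp (i e t / 2)`, in the rotating frame
  let U₁ : ℂ × ℂ × ℝ → ℝ := fun v => σ * (v.2.1.re - v.1.re) + e / 2 * v.1.im
  let U₂ : ℂ × ℂ × ℝ → ℝ := fun v => σ * (v.2.1.im - v.1.im) - e / 2 * v.1.re
  have hN : ∀ t, (u t).1.re ^ 2 + (u t).1.im ^ 2 = 0 := by
    refine moments_eq_zero_of_homoclinic (c := σ + 1) (η := σ * (r₁ - 1) - e ^ 2 / 4)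
      (κ := (σ + 1) * e / 2)
      (p := fun t => (u t).1.re * U₁ (u t) + (u t).1.im * U₂ (u t))
      (D := fun t => U₁ (u t) ^ 2 + U₂ (u t) ^ 2)
      (w := fun t => (u t).1.re * U₂ (u t) - (u t).1.im * U₁ (u t))
      (ζ := fun t => σ * (u t).2.2)
      (by positivity) hη (by positivity) (fun t => ?_) (fun t => ?_) (fun t => ?_)
      (fun t => by positivity) (fun t => by positivity) (fun t => ?_)
      (hlim (fun v => σ * v.2.2) (by fun_prop) (by simp) htop)
      (hlim (fun v => v.1.re ^ 2 + v.1.im ^ 2) (by fun_prop) (by simp) htop)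
      (hlim (fun v => v.1.re * U₁ v + v.1.im * U₂ v) (by fun_prop) (by simp) htop)
      (hlim (fun v => v.1.re * U₂ v - v.1.im * U₁ v) (by fun_prop) (by simp) hbot)
    · refine HasDerivAt.congr_deriv (((hre (hX t)).pow 2).add ((him (hX t)).pow 2)) ?_
      simp [U₁, U₂]
      ring
    · have h₁ := ((((hre (hY t)).sub (hre (hX t))).const_mul σ).add
        ((him (hX t)).const_mul (e / 2)))
      have h₂ := ((((him (hY t)).sub (him (hX t))).const_mul σ).sub
        ((hre (hX t)).const_mul (e / 2)))
      refine HasDerivAt.congr_deriv (((hre (hX t)).mul h₁).add ((him (hX t)).mul h₂)) ?_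
      simp [U₁, U₂, hlaser]
      ring
    · have h₁ := ((((hre (hY t)).sub (hre (hX t))).const_mul σ).add
        ((him (hX t)).const_mul (e / 2)))
      have h₂ := ((((him (hY t)).sub (him (hX t))).const_mul σ).sub
        ((hre (hX t)).const_mul (e / 2)))
      refine HasDerivAt.congr_deriv (((hre (hX t)).mul h₂).sub ((him (hX t)).mul h₁)) ?_
      simp [U₁, U₂, hlaser]
      ring
    · have hc : 0 < σ + 1 := by positivity
      generalize U₁ (u t) = a, U₂ (u t) = d, (u t).1.re = x, (u t).1.im = y
      rcases abs_cases (x * d - y * a) with ⟨h, -⟩ | ⟨h, -⟩ <;> rw [h]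
      · nlinarith [sq_nonneg (a + (σ + 1) / 2 * x + (σ + 1) / 2 * y),
          sq_nonneg (d + (σ + 1) / 2 * y - (σ + 1) / 2 * x)]
      · nlinarith [sq_nonneg (a + (σ + 1) / 2 * x - (σ + 1) / 2 * y),
          sq_nonneg (d + (σ + 1) / 2 * y + (σ + 1) / 2 * x)]
  have hX0 : ∀ t, (u t).1 = 0 := fun t => by
    have := hN t
    apply Complex.ext <;> simp only [Complex.zero_re, Complex.zero_im] <;>
      nlinarith [sq_nonneg (u t).1.re, sq_nonneg (u t).1.im]
  have hY0 : ∀ t, (u t).2.1 = 0 := fun t => by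
    have h := hX t
    rw [funext hX0] at h
    have h' := h.unique (hasDerivAt_const t (0 : ℂ))
    simpa [hX0, hσ.ne'] using h'
  have hZ0 : ∀ t, (u t).2.2 = 0 :=
    eq_zero_of_hasDerivAt_neg_mul_of_tendsto_atBot hb
      (fun t => by simpa [hX0] using hZ t) (hlim (fun v => v.2.2) (by fun_prop) rfl hbot)
  obtain ⟨t, s, hts⟩ := hnonconst
  exact hts (by ext <;> simp [hX0, hY0, hZ0])
end

section
/- Consider the projected system in ℝ⁴: ξ̇ = υ + μ(R − ξ) − κw − υ(1 − Z − ϱ(R + ξ)), υ̇ = −μυ + R − ξ + (R + ξ)(1 − Z − ϱ(R + ξ)), ẇ = −μw + κ(R + ξ), Ż = −βZ + R + ξ, where R = √(ξ² + υ² + w²), with real parameters μ > 0, β > 0, ϱ > 0, κ, and βϱ + 1 ≠ 0. Then the point S′₁ = (ξ₁, υ₁, w₁, Z₁) with ξ₁ = β(μ² + κ²)(μ² − κ²)/(2μ⁴(βϱ + 1)), υ₁ = 0, w₁ = βκ(μ² + κ²)/(μ³(βϱ + 1)), Z₁ = (μ² + κ²)/(μ²(βϱ + 1)) is an equilibrium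 of the system (the right-hand side vanishes at S′₁), and the origin S′₀ = (0,0,0,0) is also an equilibrium. -/
/-- **Equilibria of the projected system.**
For the projected system in ℝ⁴ with parameters μ > 0, β > 0, ϱ > 0, κ and
βϱ + 1 ≠ 0, the point S′₁ = (ξ₁, 0, w₁, Z₁) with ξ₁ = β(μ²+κ²)(μ²−κ²)/(2μ⁴(βϱ+1)),
w₁ = βκ(μ²+κ²)/(μ³(βϱ+1)), Z₁ = (μ²+κ²)/(μ²(βϱ+1)) is an equilibrium, and the
origin S′₀ = (0,0,0,0) is also an equilibrium. -/
theorem projected_system_equilibria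
    (κ μ ϱ β : ℝ) (hμ : 0 < μ) (hβ : 0 < β) (hϱ : 0 < ϱ) (hne : β * ϱ + 1 ≠ 0) :
    let F : ℝ × ℝ × ℝ × ℝ → ℝ × ℝ × ℝ × ℝ := fun p =>
      let ξ := p.1; let υ := p.2.1; let w := p.2.2.1; let Z := p.2.2.2
      let R := Real.sqrt (ξ ^ 2 + υ ^ 2 + w ^ 2)
      (υ + μ * (R - ξ) - κ * w - υ * (1 - Z - ϱ * (R + ξ)),
       -μ * υ + R - ξ + (R + ξ) * (1 - Z - ϱ * (R + ξ)),
       -μ * w + κ * (R + ξ),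
       -β * Z + R + ξ)
    F (β * (μ ^ 2 + κ ^ 2) * (μ ^ 2 - κ ^ 2) / (2 * μ ^ 4 * (β * ϱ + 1)),
       0,
       β * κ * (μ ^ 2 + κ ^ 2) / (μ ^ 3 * (β * ϱ + 1)),
       (μ ^ 2 + κ ^ 2) / (μ ^ 2 * (β * ϱ + 1))) = (0, 0, 0, 0) ∧
    F (0, 0, 0, 0) = (0, 0, 0, 0) := by
  have hD : 0 < β * ϱ + 1 := by positivity
  have hR : Real.sqrt ((β * (μ ^ 2 + κ ^ 2) * (μ ^ 2 - κ ^ 2) / (2 * μ ^ 4 * (β * ϱ + 1))) ^ 2 +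
      0 ^ 2 + (β * κ * (μ ^ 2 + κ ^ 2) / (μ ^ 3 * (β * ϱ + 1))) ^ 2) =
      β * (μ ^ 2 + κ ^ 2) ^ 2 / (2 * μ ^ 4 * (β * ϱ + 1)) := by
    rw [Real.sqrt_eq_iff_mul_self_eq (by positivity) (by positivity)]
    field_simp
    ring
  intro F
  refine ⟨?_, by simp [F]⟩
  simp only [F, hR, Prod.mk.injEq]
  refine ⟨?_, ?_, ?_, ?_⟩ <;> field_simp <;> ring
end
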